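/- arXiv:1312.1272 — 2 statements merged into one kernel-verified Lean document; each statement's English description precedes it below -/
import Mathlib

section
/- Let A be an MV-algebra. The monoid of good sequences of A satisfies the cancellation property: if a + b = a + c then b = c, for all good sequences a, b, c. -/
class MVAlgebra (A : Type*) extends Zero A where
  oplus : A → A → A
  mvneg : A → A
  oplus_assoc : ∀ x y z : A, oplus x (oplus y z) = oplus (oplus x y) z
  oplus_comm : ∀ x y : A, oplus x y = oplus y x
  oplus_zero : ∀ x : A, oplus x 0 = x
  mvneg_mvneg : ∀ x : A, mvneg (mvneg x) = x
  oplus_mvneg_zero : ∀ x : A, oplus x (mvneg 0) = mvneg 0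
  lukasiewicz : ∀ x y : A,
    oplus (mvneg (oplus (mvneg x) y)) y = oplus (mvneg (oplus (mvneg y) x)) x

open MVAlgebra

/-- The derived operation `x ⊙ y := ¬(¬x ⊕ ¬y)`. -/
def MVAlgebra.odot {A : Type*} [MVAlgebra A] (x y : A) : A :=
  mvneg (oplus (mvneg x) (mvneg y))

/-- A good sequence: `aᵢ ⊕ aᵢ₊₁ = aᵢ` for all `i`, and eventually zero. -/
def Good {A : Type*} [MVAlgebra A] (a : ℕ → A) : Prop :=
  (∀ i, oplus (a i) (a (i + 1)) = a i) ∧ ∃ N, ∀ m, N ≤ m → a m = 0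

/-- The sum of (good) sequences:
`(a + b)ₙ = aₙ ⊕ (aₙ₋₁ ⊙ b₀) ⊕ … ⊕ (a₀ ⊙ bₙ₋₁) ⊕ bₙ`. -/
def addGood {A : Type*} [MVAlgebra A] (a b : ℕ → A) : ℕ → A := fun n =>
  ((List.range n).map (fun j => odot (a (n - 1 - j)) (b j))).foldr oplus
    (oplus (a n) (b n))

namespace MVAlgebra

section Order

variable {A : Type*} [MVAlgebra A]

instance : Std.Associative (oplus : A → A → A) := ⟨fun x y z => (oplus_assoc x y z).symm⟩

instance : Std.Commutative (oplus : A → A → A) := ⟨oplus_comm⟩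

/-- Truncated difference `x ⊖ y := ¬(¬x ⊕ y)`. -/
def diff (x y : A) : A := mvneg (oplus (mvneg x) y)

theorem zero_oplus (x : A) : oplus 0 x = x := by rw [oplus_comm, oplus_zero]

theorem top_oplus (x : A) : oplus (mvneg 0) x = mvneg 0 := by
  rw [oplus_comm, oplus_mvneg_zero]

theorem mvneg_oplus_self (x : A) : oplus (mvneg x) x = mvneg 0 := by
  have h := lukasiewicz x (mvneg 0)
  rwa [oplus_mvneg_zero, mvneg_mvneg, zero_oplus, eq_comm] at h

theorem diff_oplus_of_mvneg_oplus_eq {x y : A} (h : oplus (mvneg x) y = mvneg 0) :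
    oplus (diff y x) x = y := by
  have h' := lukasiewicz x y
  rw [h, mvneg_mvneg, zero_oplus] at h'
  exact h'.symm

theorem mvneg_oplus_oplus (x z : A) : oplus (mvneg x) (oplus z x) = mvneg 0 := by
  rw [oplus_comm z, oplus_assoc, mvneg_oplus_self, top_oplus]

/-- The natural order of an MV-algebra: `x ≤ y` when `¬x ⊕ y = 1`. -/
instance : PartialOrder A where
  le x y := oplus (mvneg x) y = mvneg 0
  le_refl := mvneg_oplus_self
  le_trans x y z hxy hyz := by
    have e : oplus (oplus (diff z y) (diff y x)) x = z := by
      rw [← oplus_assoc, diff_oplus_of_mvneg_oplus_eq hxy, diff_oplus_of_mvneg_oplus_eq hyz]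
    rw [← e]
    exact mvneg_oplus_oplus x _
  le_antisymm x y hxy hyx := by
    have h := lukasiewicz x y
    rw [hxy, hyx, mvneg_mvneg, zero_oplus, zero_oplus] at h
    exact h.symm

theorem le_def {x y : A} : x ≤ y ↔ oplus (mvneg x) y = mvneg 0 := Iff.rfl

theorem diff_oplus_cancel {x y : A} (h : x ≤ y) : oplus (diff y x) x = y :=
  diff_oplus_of_mvneg_oplus_eq h

theorem le_oplus_left (x z : A) : x ≤ oplus z x := mvneg_oplus_oplus x z

theorem le_oplus_right (x z : A) : x ≤ oplus x z := by
  rw [oplus_comm]; exact le_oplus_left x z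

theorem zero_le (x : A) : 0 ≤ x := top_oplus x

theorem le_zero_iff {x : A} : x ≤ 0 ↔ x = 0 :=
  ⟨fun h => le_antisymm h (zero_le x), fun h => h.le⟩

theorem le_top (x : A) : x ≤ mvneg 0 := oplus_mvneg_zero _

theorem diff_le_iff {x y z : A} : diff x y ≤ z ↔ x ≤ oplus y z := by
  rw [le_def, le_def, diff, mvneg_mvneg, oplus_assoc]

theorem diff_le_iff' {x y z : A} : diff x y ≤ z ↔ x ≤ oplus z y := by
  rw [diff_le_iff, oplus_comm]

theorem diff_eq_zero_iff {x y : A} : diff x y = 0 ↔ x ≤ y := by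
  rw [← le_zero_iff, diff_le_iff, oplus_zero]

theorem diff_le (x y : A) : diff x y ≤ x := diff_le_iff.2 (le_oplus_left _ _)

theorem le_oplus_diff (x y : A) : x ≤ oplus y (diff x y) := diff_le_iff.1 le_rfl

theorem mvneg_le_mvneg {x y : A} (h : x ≤ y) : mvneg y ≤ mvneg x := by
  rw [le_def, mvneg_mvneg, oplus_comm]; exact h

theorem le_mvneg_comm {x y : A} (h : x ≤ mvneg y) : y ≤ mvneg x := by
  simpa only [mvneg_mvneg] using mvneg_le_mvneg h

theorem oplus_le_oplus {x y z w : A} (h : x ≤ y) (h' : z ≤ w) : oplus x z ≤ oplus y w := by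
  rw [← diff_oplus_cancel h, ← diff_oplus_cancel h']
  have e : oplus (oplus (diff y x) x) (oplus (diff w z) z) =
      oplus (oplus (diff y x) (diff w z)) (oplus x z) := by ac_rfl
  rw [e]
  exact le_oplus_left _ _

theorem diff_mvneg_mvneg (x y : A) : diff (mvneg x) (mvneg y) = diff y x := by
  rw [diff, diff, mvneg_mvneg, oplus_comm]

theorem oplus_diff_cancel {x y : A} (h : x ≤ mvneg y) : diff (oplus x y) y = x := by
  have e := diff_oplus_cancel (le_mvneg_comm h)
  rw [diff, mvneg_mvneg] at e
  rw [diff, e, mvneg_mvneg]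

theorem diff_le_triangle (x y z : A) : diff x z ≤ oplus (diff x y) (diff y z) := by
  rw [diff_le_iff]
  refine (le_oplus_diff x y).trans ?_
  have e : oplus z (oplus (diff x y) (diff y z)) = oplus (oplus z (diff y z)) (diff x y) := by
    ac_rfl
  rw [e]
  exact oplus_le_oplus (le_oplus_diff y z) le_rfl

theorem diff_oplus_oplus_le (x y z w : A) :
    diff (oplus x y) (oplus z w) ≤ oplus (diff x z) (diff y w) := by
  rw [diff_le_iff]
  have e : oplus (oplus z w) (oplus (diff x z) (diff y w)) =
      oplus (oplus z (diff x z)) (oplus w (diff y w)) := by ac_rfl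
  rw [e]
  exact oplus_le_oplus (le_oplus_diff _ _) (le_oplus_diff _ _)

/-- The meet `x ∧ y := x ⊖ (x ⊖ y)`. -/
def meet (x y : A) : A := diff x (diff x y)

theorem meet_le_left (x y : A) : meet x y ≤ x := diff_le _ _

theorem meet_le_right (x y : A) : meet x y ≤ y := by
  rw [meet, diff_le_iff']
  exact le_oplus_diff x y

theorem le_meet {w x y : A} (hx : w ≤ x) (hy : w ≤ y) : w ≤ meet x y := by
  have h : diff x y ≤ diff x w := diff_le_iff'.2
    ((diff_oplus_cancel hx).symm.le.trans (oplus_le_oplus le_rfl hy))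
  have e : diff x (diff x w) = w := by
    have hw : w ≤ mvneg (diff x w) := by
      rw [diff, mvneg_mvneg]; exact le_oplus_left _ _
    have h' := oplus_diff_cancel hw
    rwa [oplus_comm, diff_oplus_cancel hx] at h'
  rw [← e]
  exact mvneg_le_mvneg (oplus_le_oplus le_rfl h)

theorem oplus_meet_le (x y z : A) : meet (oplus x y) z ≤ oplus (meet x z) (meet y z) := by
  rw [← diff_le_iff']
  refine le_meet ?_ ((diff_le _ _).trans (meet_le_right _ _))
  rw [diff_le_iff', ← diff_le_iff]
  refine le_meet ?_ ((diff_le _ _).trans (meet_le_right _ _))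
  exact diff_le_iff.2 (meet_le_left _ _)

theorem eq_zero_of_oplus_le {x y : A} (h : x ≤ mvneg y) (h' : oplus x y ≤ y) : x = 0 := by
  rw [← oplus_diff_cancel h]
  exact diff_eq_zero_iff.2 h'

theorem meet_diff_diff (x y : A) : meet (diff x y) (diff y x) = 0 := by
  have key : ∀ u v : A, meet (diff x y) (diff y x) ≤ diff u v → meet x y ≤ u → meet x y ≤ v →
      oplus (meet (diff x y) (diff y x)) (meet x y) ≤ u := by
    intro u v h hu hv
    have e : oplus (meet u v) (diff u v) = u := diff_oplus_cancel (diff_le u v)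
    calc _ ≤ oplus (diff u v) (meet u v) := oplus_le_oplus h (le_meet hu hv)
      _ = u := by rw [oplus_comm, e]
  refine eq_zero_of_oplus_le (y := meet x y) ?_ (le_meet
    (key x y (meet_le_left _ _) (meet_le_left _ _) (meet_le_right _ _))
    (key y x (meet_le_right _ _) (meet_le_right _ _) (meet_le_left _ _)))
  exact ((meet_le_left _ _).trans (mvneg_le_mvneg (le_oplus_left y _))).trans
    (mvneg_le_mvneg (meet_le_right x y))

end Order

section Ideal

variable {A : Type*} [MVAlgebra A]

/-- Ideals of an MV-algebra. -/
structure IsIdeal (I : Set A) : Prop where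
  zero_mem : 0 ∈ I
  mem_of_le : ∀ {x y : A}, x ≤ y → y ∈ I → x ∈ I
  oplus_mem : ∀ {x y : A}, x ∈ I → y ∈ I → oplus x y ∈ I

theorem isIdeal_meet_mem {I : Set A} (hI : IsIdeal I) (p : A) : IsIdeal {z | meet z p ∈ I} where
  zero_mem := hI.mem_of_le (meet_le_left _ _) hI.zero_mem
  mem_of_le h hy := hI.mem_of_le (le_meet ((meet_le_left _ _).trans h) (meet_le_right _ _)) hy
  oplus_mem hx hy := hI.mem_of_le (oplus_meet_le _ _ _) (hI.oplus_mem hx hy)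

/-- An element `d ≠ 0` is omitted by some prime ideal. -/
theorem exists_prime_ideal {d : A} (hd : d ≠ 0) :
    ∃ I : Set A, IsIdeal I ∧ d ∉ I ∧ ∀ x y, diff x y ∈ I ∨ diff y x ∈ I := by
  obtain ⟨I, hI⟩ := zorn_subset {I : Set A | IsIdeal I ∧ d ∉ I} (by
    intro c hc hchain
    rcases c.eq_empty_or_nonempty with rfl | ⟨J, hJ⟩
    · refine ⟨{0}, ⟨⟨rfl, ?_, ?_⟩, hd⟩, by simp⟩
      · rintro x y h rfl
        exact le_zero_iff.1 h
      · rintro x y rfl rfl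
        exact oplus_zero 0
    · refine ⟨⋃₀ c, ⟨⟨⟨J, hJ, (hc hJ).1.zero_mem⟩, ?_, ?_⟩, ?_⟩,
        fun s hs => Set.subset_sUnion_of_mem hs⟩
      · rintro x y h ⟨K, hK, hy⟩
        exact ⟨K, hK, (hc hK).1.mem_of_le h hy⟩
      · rintro x y ⟨K, hK, hx⟩ ⟨L, hL, hy⟩
        rcases hchain.total hK hL with h | h
        · exact ⟨L, hL, (hc hL).1.oplus_mem (h hx) hy⟩
        · exact ⟨K, hK, (hc hK).1.oplus_mem hx (h hy)⟩
      · rintro ⟨K, hK, h⟩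
        exact (hc hK).2 h)
  have hid : IsIdeal I := hI.prop.1
  refine ⟨I, hid, hI.prop.2, fun x y => ?_⟩
  have key : ∀ p q : A, meet q p ∈ I → q ∉ I → meet d p ∈ I := by
    intro p q hqp hq
    by_contra hdp
    have hsub : {z | meet z p ∈ I} ⊆ I :=
      hI.le_of_ge ⟨isIdeal_meet_mem hid p, hdp⟩
        (fun z hz => hid.mem_of_le (meet_le_left _ _) hz)
    exact hq (hsub hqp)
  by_contra! hne
  have h₁ := key (diff y x) (diff x y) (by rw [meet_diff_diff]; exact hid.zero_mem) hne.1
  have h₂ := key d (diff y x)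
    (hid.mem_of_le (le_meet (meet_le_right _ _) (meet_le_left _ _)) h₁) hne.2
  exact hI.prop.2 (hid.mem_of_le (le_meet le_rfl le_rfl) h₂)

/-- The congruence of an ideal. -/
def idealSetoid {I : Set A} (hI : IsIdeal I) : Setoid A where
  r x y := diff x y ∈ I ∧ diff y x ∈ I
  iseqv :=
    { refl := fun x => by
        have h : diff x x = 0 := diff_eq_zero_iff.2 le_rfl
        rw [h]; exact ⟨hI.zero_mem, hI.zero_mem⟩
      symm := fun h => ⟨h.2, h.1⟩
      trans := fun h hyz => ⟨hI.mem_of_le (diff_le_triangle _ _ _) (hI.oplus_mem h.1 hyz.1),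
        hI.mem_of_le (diff_le_triangle _ _ _) (hI.oplus_mem hyz.2 h.2)⟩ }

/-- The quotient of an MV-algebra by an ideal. -/
@[reducible]
def quotientMVAlgebra {I : Set A} (hI : IsIdeal I) : MVAlgebra (Quotient (idealSetoid hI)) where
  zero := Quotient.mk _ 0
  oplus := Quotient.map₂ oplus fun _ _ h _ _ h' =>
    ⟨hI.mem_of_le (diff_oplus_oplus_le _ _ _ _) (hI.oplus_mem h.1 h'.1),
      hI.mem_of_le (diff_oplus_oplus_le _ _ _ _) (hI.oplus_mem h.2 h'.2)⟩
  mvneg := Quotient.map mvneg fun x y h => by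
    change diff _ _ ∈ I ∧ diff _ _ ∈ I
    rw [diff_mvneg_mvneg, diff_mvneg_mvneg]
    exact ⟨h.2, h.1⟩
  oplus_assoc := by
    rintro ⟨x⟩ ⟨y⟩ ⟨z⟩; exact congrArg (Quotient.mk _) (oplus_assoc x y z)
  oplus_comm := by
    rintro ⟨x⟩ ⟨y⟩; exact congrArg (Quotient.mk _) (oplus_comm x y)
  oplus_zero := by
    rintro ⟨x⟩; exact congrArg (Quotient.mk _) (oplus_zero x)
  mvneg_mvneg := by
    rintro ⟨x⟩; exact congrArg (Quotient.mk _) (mvneg_mvneg x)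
  oplus_mvneg_zero := by
    rintro ⟨x⟩; exact congrArg (Quotient.mk _) (oplus_mvneg_zero x)
  lukasiewicz := by
    rintro ⟨x⟩ ⟨y⟩; exact congrArg (Quotient.mk _) (lukasiewicz x y)

end Ideal

/-- Homomorphisms of MV-algebras. -/
structure IsHom {A B : Type*} [MVAlgebra A] [MVAlgebra B] (f : A → B) : Prop where
  map_zero : f 0 = 0
  map_oplus : ∀ x y, f (oplus x y) = oplus (f x) (f y)
  map_mvneg : ∀ x, f (mvneg x) = mvneg (f x)

/-- Distinct elements are separated by a homomorphism to an MV-chain. -/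
theorem exists_hom_chain_ne.{u} {A : Type u} [MVAlgebra A] {x y : A} (hxy : x ≠ y) :
    ∃ (B : Type u) (_ : MVAlgebra B) (f : A → B), IsHom f ∧
      (∀ u v : B, u ≤ v ∨ v ≤ u) ∧ f x ≠ f y := by
  have hd : oplus (diff x y) (diff y x) ≠ 0 := by
    intro h
    refine hxy (le_antisymm (diff_eq_zero_iff.1 (le_zero_iff.1 ?_))
      (diff_eq_zero_iff.1 (le_zero_iff.1 ?_))) <;> rw [← h]
    · exact le_oplus_right _ _
    · exact le_oplus_left _ _
  obtain ⟨I, hI, hdI, hprime⟩ := exists_prime_ideal hd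
  let := quotientMVAlgebra hI
  refine ⟨Quotient (idealSetoid hI), inferInstance, Quotient.mk (idealSetoid hI),
    ⟨rfl, fun _ _ => rfl, fun _ => rfl⟩, ?_, ?_⟩
  · have hdiff : ∀ u v : A, diff u v ∈ I →
        diff (Quotient.mk (idealSetoid hI) u) (Quotient.mk (idealSetoid hI) v) = 0 :=
      fun u v h => Quotient.sound (s := idealSetoid hI) (a := diff u v)
        ⟨hI.mem_of_le (diff_le _ _) h, hI.mem_of_le (diff_le _ _) hI.zero_mem⟩
    rintro ⟨u⟩ ⟨v⟩
    exact (hprime u v).imp (fun h => diff_eq_zero_iff.1 (hdiff u v h))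
      (fun h => diff_eq_zero_iff.1 (hdiff v u h))
  · intro h
    have h' := Quotient.exact h
    exact hdI (hI.oplus_mem h'.1 h'.2)

section Map

variable {A B : Type*} [MVAlgebra A] [MVAlgebra B] {f : A → B}

theorem IsHom.map_odot (hf : IsHom f) (x y : A) : f (odot x y) = odot (f x) (f y) := by
  simp only [odot, hf.map_mvneg, hf.map_oplus]

theorem IsHom.good_comp (hf : IsHom f) {a : ℕ → A} (ha : Good a) : Good (f ∘ a) := by
  obtain ⟨h, N, hN⟩ := ha
  refine ⟨fun i => ?_, N, fun m hm => ?_⟩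
  · simp only [Function.comp_apply, ← hf.map_oplus, h i]
  · simp only [Function.comp_apply, hN m hm, hf.map_zero]

theorem IsHom.comp_addGood (hf : IsHom f) (a b : ℕ → A) :
    f ∘ addGood a b = addGood (f ∘ a) (f ∘ b) := by
  have key : ∀ (l : List ℕ) (g : ℕ → A) (z : A),
      f ((l.map g).foldr oplus z) = (l.map (fun j => f (g j))).foldr oplus (f z) := by
    intro l g z
    induction l with
    | nil => rfl
    | cons j l ih => simp only [List.map_cons, List.foldr_cons, hf.map_oplus, ih]
  funext n
  simp only [addGood, Function.comp_apply, key, hf.map_odot, hf.map_oplus]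

end Map

section Chain

variable {A : Type*} [MVAlgebra A]

theorem odot_zero_left (x : A) : odot 0 x = 0 := by
  rw [odot, top_oplus, mvneg_mvneg]

theorem odot_top_left (x : A) : odot (mvneg 0) x = x := by
  rw [odot, mvneg_mvneg, zero_oplus, mvneg_mvneg]

theorem odot_top_right (x : A) : odot x (mvneg 0) = x := by
  rw [odot, mvneg_mvneg, oplus_zero, mvneg_mvneg]

theorem odot_le_left (x y : A) : odot x y ≤ x := by
  have h := mvneg_le_mvneg (le_oplus_right (mvneg x) (mvneg y))
  rwa [mvneg_mvneg] at h

theorem odot_eq_zero_iff {x y : A} : odot x y = 0 ↔ y ≤ mvneg x := by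
  have h : odot x y = diff y (mvneg x) := by rw [odot, diff, oplus_comm]
  rw [h, diff_eq_zero_iff]

theorem mvneg_inj {x y : A} (h : mvneg x = mvneg y) : x = y := by
  rw [← mvneg_mvneg x, h, mvneg_mvneg]

theorem eq_of_oplus_le_of_le_mvneg {x y z : A} (hyz : y ≤ z) (hz : z ≤ mvneg x)
    (h : oplus z x ≤ oplus y x) : y = z := by
  have e : oplus y x = oplus z x := le_antisymm (oplus_le_oplus hyz le_rfl) h
  rw [← oplus_diff_cancel hz, ← e, oplus_diff_cancel (hyz.trans hz)]

/-- In a chain, `y` is determined by `y ⊕ x` and `x ⊙ y`. -/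
theorem eq_of_oplus_le_of_odot_le (hA : ∀ u v : A, u ≤ v ∨ v ≤ u) {x y z : A} (hyz : y ≤ z)
    (h : oplus z x ≤ oplus y x) (h' : odot x z ≤ odot x y) : y = z := by
  rcases hA z (mvneg x) with hz | hz
  · exact eq_of_oplus_le_of_le_mvneg hyz hz h
  rcases hA y (mvneg x) with hy | hy
  · rw [odot_eq_zero_iff.2 hy, le_zero_iff, odot_eq_zero_iff] at h'
    exact eq_of_oplus_le_of_le_mvneg hyz h' h
  · refine (mvneg_inj (eq_of_oplus_le_of_le_mvneg (x := mvneg x) (mvneg_le_mvneg hyz)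
      (mvneg_le_mvneg hy) ?_)).symm
    have h₂ := mvneg_le_mvneg h'
    rw [odot, odot, mvneg_mvneg, mvneg_mvneg] at h₂
    rwa [oplus_comm, oplus_comm (mvneg z)]

theorem good_dichotomy (hA : ∀ u v : A, u ≤ v ∨ v ≤ u) {a : ℕ → A} (ha : Good a) (i : ℕ) :
    a i = mvneg 0 ∨ a (i + 1) = 0 := by
  have h := ha.1 i
  rcases hA (a (i + 1)) (mvneg (a i)) with h' | h'
  · right
    refine eq_zero_of_oplus_le h' ?_
    rw [oplus_comm, h]
  · left
    rw [← h, oplus_comm, ← mvneg_mvneg (a i), oplus_comm]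
    simpa only [le_def, mvneg_mvneg] using h'

theorem foldr_oplus_map_eq {l : List ℕ} {g : ℕ → A} (hg : ∀ j ∈ l, g j = 0) (z : A) :
    (l.map g).foldr oplus z = z := by
  induction l with
  | nil => rfl
  | cons j l ih =>
    rw [List.map_cons, List.foldr_cons, hg j (by simp), zero_oplus,
      ih fun k hk => hg k (List.mem_cons_of_mem _ hk)]

theorem addGood_zero (a b : ℕ → A) : addGood a b 0 = oplus (a 0) (b 0) := rfl

theorem addGood_succ (a b : ℕ → A) (n : ℕ) :
    addGood a b (n + 1) = ((List.range n).map (fun j => odot (a (n - j)) (b j))).foldr oplus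
      (oplus (odot (a 0) (b n)) (oplus (a (n + 1)) (b (n + 1)))) := by
  simp [addGood, List.range_succ]

theorem addGood_succ_of_tail_eq_zero {a : ℕ → A} (ha : ∀ i, a (i + 1) = 0) (b : ℕ → A) (n : ℕ) :
    addGood a b (n + 1) = oplus (odot (a 0) (b n)) (b (n + 1)) := by
  rw [addGood_succ, foldr_oplus_map_eq, ha, zero_oplus]
  intro j hj
  obtain ⟨k, hk⟩ : ∃ k, n - j = k + 1 := ⟨n - j - 1, by have := List.mem_range.1 hj; omega⟩
  rw [hk, ha, odot_zero_left]

theorem addGood_succ_of_head_eq_top {a b : ℕ → A} (ha : a 0 = mvneg 0) (hb : Good b) (n : ℕ) :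
    addGood a b (n + 1) = addGood (fun i => a (i + 1)) b n := by
  have e : oplus (b n) (oplus (a (n + 1)) (b (n + 1))) = oplus (a (n + 1)) (b n) := by
    conv_rhs => rw [← hb.1 n]
    ac_rfl
  rw [addGood_succ, ha, odot_top_left, e, addGood]
  congr 1
  refine List.map_congr_left fun j hj => ?_
  have hj' := List.mem_range.1 hj
  rw [show n - 1 - j + 1 = n - j by omega]

theorem eq_of_addGood_eq_of_le (hA : ∀ u v : A, u ≤ v ∨ v ≤ u) {a b c : ℕ → A}
    (ha : ∀ i, a (i + 1) = 0) (hb : Good b) (hc : Good c) (h : addGood a b = addGood a c)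
    {n : ℕ} (hn : b n ≤ c n) : b n = c n := by
  by_contra hne
  have hb_next : b (n + 1) = 0 := by
    refine (good_dichotomy hA hb n).resolve_left fun hb_top => hne (le_antisymm hn ?_)
    rw [hb_top]; exact le_top _
  refine hne (eq_of_oplus_le_of_odot_le hA (x := a 0) hn ?_ ?_)
  · rcases n with _ | n
    · have h₀ := congrFun h 0
      rw [addGood_zero, addGood_zero] at h₀
      rw [oplus_comm, ← h₀, oplus_comm]
    · have h₁ := congrFun h (n + 1)
      rw [addGood_succ_of_tail_eq_zero ha, addGood_succ_of_tail_eq_zero ha] at h₁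
      have hc_prev : c n = mvneg 0 := by
        refine (good_dichotomy hA hc n).resolve_right fun hc_zero => hne (le_antisymm hn ?_)
        rw [hc_zero]; exact zero_le _
      rw [hc_prev, odot_top_right] at h₁
      rw [oplus_comm, ← h₁, oplus_comm (b (n + 1))]
      exact oplus_le_oplus (odot_le_left _ _) le_rfl
  · have h₁ := congrFun h (n + 1)
    rw [addGood_succ_of_tail_eq_zero ha, addGood_succ_of_tail_eq_zero ha, hb_next,
      oplus_zero] at h₁
    rw [h₁]
    exact le_oplus_right _ _

theorem addGood_left_cancel_of_chain (hA : ∀ u v : A, u ≤ v ∨ v ≤ u) {b c : ℕ → A}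
    (hb : Good b) (hc : Good c) (N : ℕ) :
    ∀ a : ℕ → A, Good a → (∀ m, N < m → a m = 0) → addGood a b = addGood a c → b = c := by
  have base : ∀ a : ℕ → A, (∀ i, a (i + 1) = 0) → addGood a b = addGood a c → b = c := by
    intro a ha h
    funext n
    rcases hA (b n) (c n) with hn | hn
    · exact eq_of_addGood_eq_of_le hA ha hb hc h hn
    · exact (eq_of_addGood_eq_of_le hA ha hc hb h.symm hn).symm
  induction N with
  | zero => exact fun a _ hN => base a fun i => hN _ i.succ_pos
  | succ N ih =>
    intro a ha hN h
    rcases good_dichotomy hA ha 0 with h₀ | h₀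
    · refine ih (fun i => a (i + 1)) ⟨fun i => ha.1 (i + 1), N + 1, fun m hm => hN _ (by omega)⟩
        (fun m hm => hN _ (by omega)) (funext fun n => ?_)
      rw [← addGood_succ_of_head_eq_top h₀ hb, ← addGood_succ_of_head_eq_top h₀ hc, h]
    · refine base a (fun i => ?_) h
      induction i with
      | zero => exact h₀
      | succ i hi =>
        have h₁ := ha.1 (i + 1)
        rwa [hi, zero_oplus] at h₁

end Chain

end MVAlgebra

/-- The monoid of good sequences of an MV-algebra satisfies cancellation:
`a + b = a + c` implies `b = c`. -/
theorem good_sequences_cancellation (A : Type*) [MVAlgebra A]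
    (a b c : ℕ → A) (ha : Good a) (hb : Good b) (hc : Good c)
    (h : addGood a b = addGood a c) : b = c := by
  funext n
  by_contra hne
  obtain ⟨B, _, f, hf, hB, hfne⟩ := exists_hom_chain_ne hne
  obtain ⟨N, hN⟩ := (hf.good_comp ha).2
  refine hfne (congrFun (addGood_left_cancel_of_chain hB (hf.good_comp hb) (hf.good_comp hc) N
    (f ∘ a) (hf.good_comp ha) (fun m hm => hN m hm.le) ?_) n)
  rw [← hf.comp_addGood, ← hf.comp_addGood, h]
end

section
/- Let G be an abelian ℓ-group with strong unit u, and let Γ(G) = [0,u] be its unit interval MV-algebra. For each element b ≥ 0 of G there exists a unique good sequence (b₁, …, bₙ, 0, …) with values bᵢ in [0,u] such that b₁ + … + bₙ = b. -/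
section GoodSequence

variable {G : Type*} [Lattice G] [AddCommGroup G]

/-- What remains of `b` after subtracting the first `n` terms of its good sequence. -/
def goodRemainder (u b : G) : ℕ → G
  | 0 => b
  | n + 1 => goodRemainder u b n - u ⊓ goodRemainder u b n

lemma sum_inf_goodRemainder_add (u b : G) (n : ℕ) :
    ∑ i ∈ Finset.range n, u ⊓ goodRemainder u b i + goodRemainder u b n = b := by
  induction n with
  | zero => simp [goodRemainder]
  | succ n ih => rw [Finset.sum_range_succ, goodRemainder, add_assoc, add_sub_cancel, ih]

variable [AddLeftMono G] {u : G}

/-- Truncating the summand `t` at `u` does not change the truncated sum, if `0 ≤ a`. -/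
lemma inf_add_inf_of_nonneg {a t : G} (ha : 0 ≤ a) : u ⊓ (a + u ⊓ t) = u ⊓ (a + t) := by
  rw [add_inf, ← inf_assoc, inf_eq_left.2 (le_add_of_nonneg_left ha)]

/-- The first term of a good sequence is the truncation at `u` of any nonempty partial sum. -/
lemma inf_sum_range_succ_of_good (n : ℕ) (s : ℕ → G) (hs : ∀ i, 0 ≤ s i ∧ s i ≤ u)
    (hgood : ∀ i, u ⊓ (s i + s (i + 1)) = s i) :
    u ⊓ ∑ i ∈ Finset.range (n + 1), s i = s 0 := by
  induction n generalizing s with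
  | zero => simpa using (hs 0).2
  | succ n ih =>
    rw [Finset.sum_range_succ', add_comm, ← inf_add_inf_of_nonneg (hs 0).1,
      ih (fun i => s (i + 1)) (fun i => hs (i + 1)) (fun i => hgood (i + 1))]
    exact hgood 0

/-- Good sequences with equal `n`-th partial sums agree on the first `n` terms. -/
lemma eq_of_sum_range_eq_of_good (n : ℕ) (s t : ℕ → G)
    (hs : ∀ i, 0 ≤ s i ∧ s i ≤ u) (hsgood : ∀ i, u ⊓ (s i + s (i + 1)) = s i)
    (ht : ∀ i, 0 ≤ t i ∧ t i ≤ u) (htgood : ∀ i, u ⊓ (t i + t (i + 1)) = t i)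
    (h : ∑ i ∈ Finset.range n, s i = ∑ i ∈ Finset.range n, t i) :
    ∀ i < n, s i = t i := by
  induction n generalizing s t with
  | zero => simp
  | succ n ih =>
    have h0 : s 0 = t 0 := by
      rw [← inf_sum_range_succ_of_good n s hs hsgood, h,
        inf_sum_range_succ_of_good n t ht htgood]
    rw [Finset.sum_range_succ', Finset.sum_range_succ', h0] at h
    have htail := ih (fun i => s (i + 1)) (fun i => t (i + 1)) (fun i => hs (i + 1))
      (fun i => hsgood (i + 1)) (fun i => ht (i + 1)) (fun i => htgood (i + 1))
      (add_right_cancel h)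
    rintro (_ | i) hi
    · exact h0
    · exact htail i (Nat.lt_of_succ_lt_succ hi)

lemma goodRemainder_nonneg {b : G} (hb : 0 ≤ b) (n : ℕ) : 0 ≤ goodRemainder u b n := by
  cases n with
  | zero => exact hb
  | succ n => exact sub_nonneg.2 inf_le_right

lemma goodRemainder_le {b : G} (hu : 0 ≤ u) (m k : ℕ) (h : b ≤ (m + k) • u) :
    goodRemainder u b m ≤ k • u := by
  induction m generalizing k with
  | zero => simpa [goodRemainder] using h
  | succ m ih =>
    have hm : goodRemainder u b m ≤ k • u + u := by
      rw [← succ_nsmul]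
      exact ih (k + 1) (by rwa [← add_assoc, add_right_comm])
    rw [goodRemainder, sub_le_iff_le_add, add_inf]
    exact le_inf hm (le_add_of_nonneg_left (nsmul_nonneg hu k))

lemma inf_goodRemainder_good {b : G} (hu : 0 ≤ u) (hb : 0 ≤ b) (i : ℕ) :
    u ⊓ (u ⊓ goodRemainder u b i + u ⊓ goodRemainder u b (i + 1)) =
      u ⊓ goodRemainder u b i := by
  rw [inf_add_inf_of_nonneg (le_inf hu (goodRemainder_nonneg hb i)), goodRemainder,
    add_sub_cancel]

end GoodSequence


/-- Let `G` be an abelian ℓ-group with strong unit `u`. For every `b ≥ 0` in `G`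
there is a unique good sequence with values in the unit-interval MV-algebra
`[0,u]` (i.e. an eventually zero sequence `s` with `0 ≤ sᵢ ≤ u` and
`sᵢ ⊕ sᵢ₊₁ = sᵢ`, where `x ⊕ y = inf(u, x+y)`) whose sum is `b`. -/
theorem good_sequence_representation (G : Type*)
    [Lattice G] [AddCommGroup G] [CovariantClass G G (· + ·) (· ≤ ·)]
    (u : G) (hu : 0 ≤ u) (hstrong : ∀ x : G, ∃ n : ℕ, x ≤ n • u)
    (b : G) (hb : 0 ≤ b) :
    ∃! s : ℕ → G,
      (∀ i, 0 ≤ s i ∧ s i ≤ u) ∧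
      (∀ i, u ⊓ (s i + s (i + 1)) = s i) ∧
      ∃ n : ℕ, (∀ r, n ≤ r → s r = 0) ∧ ∑ i ∈ Finset.range n, s i = b := by
  obtain ⟨n, hn⟩ := hstrong b
  have hzero : ∀ r, n ≤ r → goodRemainder u b r = 0 := fun r hr =>
    le_antisymm
      (by simpa using goodRemainder_le hu r 0 (hn.trans (nsmul_le_nsmul_left hu hr)))
      (goodRemainder_nonneg hb r)
  refine existsUnique_of_exists_of_unique
    ⟨fun i => u ⊓ goodRemainder u b i,
      fun i => ⟨le_inf hu (goodRemainder_nonneg hb i), inf_le_left⟩,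
      inf_goodRemainder_good hu hb, n, fun r hr => ?_, ?_⟩ ?_
  · simpa [hzero r hr] using hu
  · simpa [hzero n le_rfl] using sum_inf_goodRemainder_add u b n
  · rintro s t ⟨hs, hsgood, k, hk, hsum⟩ ⟨ht, htgood, l, hl, htsum⟩
    funext i
    let N := k + l + i + 1
    refine eq_of_sum_range_eq_of_good N s t hs hsgood ht htgood ?_ i (by omega)
    rw [Finset.eventually_constant_sum hk (by omega : k ≤ N),
      Finset.eventually_constant_sum hl (by omega : l ≤ N), hsum, htsum]
end
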